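/- The swap distance of any two realizations of the same bipartite degree sequence is at most 2e, where e is the number of edges of either realization. Equivalently, in the graph 𝔾 whose vertices are all realizations of a fixed bipartite degree sequence and whose edges join realizations differing by a single swap, the diameter is at most 2e. -/

import Mathlib

/-- Number of edges of the bipartite graph with edge set `E` incident to `u ∈ U`
(the degree of `u`). -/
def degU {U V : Type*} [DecidableEq U] (E : Finset (U × V)) (u : U) : ℕ :=
  (E.filter fun p => p.1 = u).card

/-- The degree of `v ∈ V` in the bipartite graph with edge set `E`. -/
def degV {U V : Type*} [DecidableEq V] (E : Finset (U × V)) (v : V) : ℕ :=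
  (E.filter fun p => p.2 = v).card

/-- The neighbourhood `Γ(v) ⊆ U` of a vertex `v ∈ V`. -/
def nbrU {U V : Type*} [DecidableEq U] [DecidableEq V] (E : Finset (U × V)) (v : V) :
    Finset U :=
  (E.filter fun p => p.2 = v).image Prod.fst

/-- The swap on `(u₁,u₂; v₁,v₂)` is allowed in the bipartite graph with edge set `E`:
for some `j ∈ {1,2}`, the edges `(u₁,v_j), (u₂,v_{3-j})` are present and the edges
`(u₁,v_{3-j}), (u₂,v_j)` are absent. -/
def SwapAllowed {U V : Type*} [DecidableEq U] [DecidableEq V] (E : Finset (U × V))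
    (u₁ u₂ : U) (v₁ v₂ : V) : Prop :=
  ((u₁, v₁) ∈ E ∧ (u₂, v₂) ∈ E ∧ (u₁, v₂) ∉ E ∧ (u₂, v₁) ∉ E) ∨
  ((u₁, v₂) ∈ E ∧ (u₂, v₁) ∈ E ∧ (u₁, v₁) ∉ E ∧ (u₂, v₂) ∉ E)

/-- The result of performing the swap on `(u₁,u₂; v₁,v₂)`: the two present edges among
the four positions are replaced by the two absent ones (symmetric difference with the
four positions). -/
def swapResult {U V : Type*} [DecidableEq U] [DecidableEq V] (E : Finset (U × V))
    (u₁ u₂ : U) (v₁ v₂ : V) : Finset (U × V) :=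
  (E \ {(u₁, v₁), (u₁, v₂), (u₂, v₁), (u₂, v₂)}) ∪
    ({(u₁, v₁), (u₁, v₂), (u₂, v₁), (u₂, v₂)} \ E)

/-- `E'` is obtained from `E` by a single allowed swap. -/
def IsSwap {U V : Type*} [DecidableEq U] [DecidableEq V] (E E' : Finset (U × V)) : Prop :=
  ∃ u₁ u₂ v₁ v₂, SwapAllowed E u₁ u₂ v₁ v₂ ∧ E' = swapResult E u₁ u₂ v₁ v₂

/-- `E` can be transformed into `E'` by a sequence of `m` swaps (each intermediate
edge set is a realization of the same bipartite degree sequence, since swaps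
preserve all degrees). -/
def SwapChain {U V : Type*} [DecidableEq U] [DecidableEq V] (E E' : Finset (U × V))
    (m : ℕ) : Prop :=
  ∃ f : ℕ → Finset (U × V), f 0 = E ∧ f m = E' ∧ ∀ i < m, IsSwap (f i) (f (i + 1))

/-- The swap distance between two realizations: the minimum number of swaps needed
to transform one into the other (equivalently, the graph distance in the Markov
graph `𝔾` whose vertices are the realizations and whose edges are single swaps). -/
noncomputable def swapDist {U V : Type*} [DecidableEq U] [DecidableEq V]
    (E₁ E₂ : Finset (U × V)) : ℕ :=
  sInf {m : ℕ | SwapChain E₁ E₂ m}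

theorem exists_mem_of_degU_eq {U V : Type*} [DecidableEq U] {E F : Finset (U × V)} {u : U} {v : V}
    (h : degU E u = degU F u) (hE : (u, v) ∈ E) (hF : (u, v) ∉ F) : ∃ w, (u, w) ∈ F ∧ (u, w) ∉ E := by
  by_contra! hcon
  have hsub : F.filter (fun p => p.1 = u) ⊆ E.filter fun p => p.1 = u := by
    rintro ⟨x, w⟩ hp
    rw [Finset.mem_filter] at hp ⊢
    obtain ⟨hp, rfl⟩ := hp
    exact ⟨hcon w hp, rfl⟩
  have heq := Finset.eq_of_subset_of_card_le hsub h.le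
  have : (u, v) ∈ F.filter fun p => p.1 = u := heq ▸ Finset.mem_filter.2 ⟨hE, rfl⟩
  exact hF (Finset.mem_filter.1 this).1

theorem exists_mem_of_degV_eq {U V : Type*} [DecidableEq V] {E F : Finset (U × V)} {u : U} {v : V}
    (h : degV E v = degV F v) (hE : (u, v) ∈ E) (hF : (u, v) ∉ F) : ∃ w, (w, v) ∈ F ∧ (w, v) ∉ E := by
  by_contra! hcon
  have hsub : F.filter (fun p => p.2 = v) ⊆ E.filter fun p => p.2 = v := by
    rintro ⟨w, x⟩ hp
    rw [Finset.mem_filter] at hp ⊢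
    obtain ⟨hp, rfl⟩ := hp
    exact ⟨hcon w hp, rfl⟩
  have heq := Finset.eq_of_subset_of_card_le hsub h.le
  have : (u, v) ∈ F.filter fun p => p.2 = v := heq ▸ Finset.mem_filter.2 ⟨hE, rfl⟩
  exact hF (Finset.mem_filter.1 this).1

section Swap

variable {U V : Type*} [DecidableEq U] [DecidableEq V]

theorem mem_swapResult {E : Finset (U × V)} {a b : U} {c d : V} {p : U × V} :
    p ∈ swapResult E a b c d ↔
      Xor (p ∈ E) (p ∈ ({(a, c), (a, d), (b, c), (b, d)} : Finset (U × V))) := by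
  simp only [swapResult, Finset.mem_union, Finset.mem_sdiff, Xor]

theorem swapResult_swapResult (E : Finset (U × V)) (a b : U) (c d : V) :
    swapResult (swapResult E a b c d) a b c d = E := by
  ext p
  simp only [mem_swapResult, Xor]
  tauto

theorem swapAllowed_swapResult {E : Finset (U × V)} {a b : U} {c d : V}
    (h : SwapAllowed E a b c d) : SwapAllowed (swapResult E a b c d) a b c d := by
  have hiff : ∀ p ∈ ({(a, c), (a, d), (b, c), (b, d)} : Finset (U × V)),
      (p ∈ swapResult E a b c d ↔ p ∉ E) := fun p hp => by simp [mem_swapResult, Xor, hp]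
  rw [SwapAllowed, hiff (a, c) (by simp), hiff (a, d) (by simp), hiff (b, c) (by simp),
    hiff (b, d) (by simp)]
  rcases h with ⟨h1, h2, h3, h4⟩ | ⟨h1, h2, h3, h4⟩
  · exact .inr ⟨h3, h4, not_not.2 h1, not_not.2 h2⟩
  · exact .inl ⟨h3, h4, not_not.2 h1, not_not.2 h2⟩

theorem IsSwap.symm {E E' : Finset (U × V)} (h : IsSwap E E') : IsSwap E' E := by
  obtain ⟨a, b, c, d, hall, rfl⟩ := h
  exact ⟨a, b, c, d, swapAllowed_swapResult hall, (swapResult_swapResult E a b c d).symm⟩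

/-- The change of an additive edge statistic under a swap. -/
theorem sum_swapResult_add {E : Finset (U × V)} {a b : U} {c d : V} (hac : (a, c) ∈ E)
    (hbd : (b, d) ∈ E) (had : (a, d) ∉ E) (hbc : (b, c) ∉ E) (f : U × V → ℕ) :
    ∑ p ∈ swapResult E a b c d, f p + (f (a, c) + f (b, d)) =
      ∑ p ∈ E, f p + (f (a, d) + f (b, c)) := by
  have hab : a ≠ b := by rintro rfl; exact hbc hac
  have hcd : c ≠ d := by rintro rfl; exact had hac
  have key : swapResult E a b c d ∪ {(a, c), (b, d)} = E ∪ {(a, d), (b, c)} := by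
    ext p
    simp only [Finset.mem_union, mem_swapResult, Xor, Finset.mem_insert, Finset.mem_singleton]
    by_cases h1 : p = (a, c)
    · subst h1; tauto
    by_cases h2 : p = (b, d)
    · subst h2; tauto
    by_cases h3 : p = (a, d)
    · subst h3; tauto
    by_cases h4 : p = (b, c)
    · subst h4; tauto
    tauto
  have hsum := congrArg (fun s : Finset (U × V) => ∑ p ∈ s, f p) key
  have d1 : Disjoint (swapResult E a b c d) {(a, c), (b, d)} := by
    simp [mem_swapResult, Xor, hac, hbd]
  have d2 : Disjoint E {(a, d), (b, c)} := by
    simp [had, hbc]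
  have n1 : (a, c) ≠ (b, d) := fun h => hab (congrArg Prod.fst h)
  have n2 : (a, d) ≠ (b, c) := fun h => hab (congrArg Prod.fst h)
  simpa only [Finset.sum_union d1, Finset.sum_union d2, Finset.sum_pair n1,
    Finset.sum_pair n2] using hsum

/-- `E` and `E'` are realizations of the same bipartite degree sequence. -/
def SameDegrees (E E' : Finset (U × V)) : Prop :=
  (∀ u, degU E u = degU E' u) ∧ ∀ v, degV E v = degV E' v

theorem SameDegrees.symm {E E' : Finset (U × V)} (h : SameDegrees E E') : SameDegrees E' E :=
  ⟨fun u => (h.1 u).symm, fun v => (h.2 v).symm⟩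

theorem SameDegrees.trans {E E' E'' : Finset (U × V)} (h : SameDegrees E E')
    (h' : SameDegrees E' E'') : SameDegrees E E'' :=
  ⟨fun u => (h.1 u).trans (h'.1 u), fun v => (h.2 v).trans (h'.2 v)⟩

theorem SameDegrees.card_eq {E E' : Finset (U × V)} (h : SameDegrees E E') :
    E.card = E'.card := by
  have key : ∀ F ⊆ E ∪ E', F.card = ∑ u ∈ (E ∪ E').image Prod.fst, degU F u := fun F hF =>
    Finset.card_eq_sum_card_fiberwise fun p hp => Finset.mem_image_of_mem _ (hF hp)
  rw [key E Finset.subset_union_left, key E' Finset.subset_union_right]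
  exact Finset.sum_congr rfl fun u _ => h.1 u

theorem sameDegrees_swapResult {E : Finset (U × V)} {a b : U} {c d : V} (hac : (a, c) ∈ E)
    (hbd : (b, d) ∈ E) (had : (a, d) ∉ E) (hbc : (b, c) ∉ E) :
    SameDegrees (swapResult E a b c d) E := by
  constructor
  · intro u
    have := sum_swapResult_add hac hbd had hbc fun p => if p.1 = u then 1 else 0
    dsimp only at this
    simp only [degU, Finset.card_filter]
    omega
  · intro v
    have := sum_swapResult_add hac hbd had hbc fun p => if p.2 = v then 1 else 0
    dsimp only at this
    simp only [degV, Finset.card_filter]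
    omega

/-- A swap that removes two edges outside `F` and adds at least one edge of `F` moves the graph
closer to `F`. -/
theorem exists_isSwap_closer {E F : Finset (U × V)} {a b : U} {c d : V} (hac : (a, c) ∈ E)
    (hbd : (b, d) ∈ E) (had : (a, d) ∉ E) (hbc : (b, c) ∉ E) (hac' : (a, c) ∉ F)
    (hbd' : (b, d) ∉ F) (had' : (a, d) ∈ F) :
    ∃ E', IsSwap E E' ∧ SameDegrees E' E ∧ (E' \ F).card < (E \ F).card := by
  refine ⟨_, ⟨a, b, c, d, Or.inl ⟨hac, hbd, had, hbc⟩, rfl⟩,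
    sameDegrees_swapResult hac hbd had hbc, ?_⟩
  have := sum_swapResult_add hac hbd had hbc fun p => if p ∉ F then 1 else 0
  simp only [Finset.sdiff_eq_filter, Finset.card_filter]
  simp only [hac', hbd', had', not_true_eq_false, not_false_eq_true, if_true, if_false] at this
  split_ifs at this <;> omega

/-- A swap that removes an edge outside `F` and adds two edges of `F` moves the graph
closer to `F`. -/
theorem exists_isSwap_closer' {E F : Finset (U × V)} {a b : U} {c d : V} (hac : (a, c) ∈ E)
    (hbd : (b, d) ∈ E) (had : (a, d) ∉ E) (hbc : (b, c) ∉ E) (hac' : (a, c) ∉ F)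
    (had' : (a, d) ∈ F) (hbc' : (b, c) ∈ F) :
    ∃ E', IsSwap E E' ∧ SameDegrees E' E ∧ (E' \ F).card < (E \ F).card := by
  refine ⟨_, ⟨a, b, c, d, Or.inl ⟨hac, hbd, had, hbc⟩, rfl⟩,
    sameDegrees_swapResult hac hbd had hbc, ?_⟩
  have := sum_swapResult_add hac hbd had hbc fun p => if p ∉ F then 1 else 0
  simp only [Finset.sdiff_eq_filter, Finset.card_filter]
  simp only [hac', had', hbc', not_true_eq_false, not_false_eq_true, if_true, if_false] at this
  split_ifs at this <;> omega

/-- Two distinct realizations can be brought closer by a single swap in one of them. -/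
theorem SameDegrees.exists_isSwap_closer {E F : Finset (U × V)} (h : SameDegrees E F)
    (hne : (E \ F).Nonempty) :
    (∃ E', IsSwap E E' ∧ SameDegrees E' E ∧ (E' \ F).card < (E \ F).card) ∨
      ∃ F', IsSwap F F' ∧ SameDegrees F' F ∧ (F' \ E).card < (F \ E).card := by
  obtain ⟨⟨a, c⟩, hac, hmax⟩ :=
    Finset.exists_max_image (E \ F) (fun p => degU (E \ F) p.1) hne
  rw [Finset.mem_sdiff] at hac
  obtain ⟨d, hadF, hadE⟩ := exists_mem_of_degU_eq (h.1 a) hac.1 hac.2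
  obtain ⟨b, hbdE, hbdF⟩ := exists_mem_of_degV_eq (h.2 d).symm hadF hadE
  -- Otherwise every neighbour of `a` in `E \ F` is one of `b`, and so is `d`.
  have hex : ∃ x, (a, x) ∈ E ∧ (a, x) ∉ F ∧ ¬((b, x) ∈ E ∧ (b, x) ∉ F) := by
    by_contra! hcon
    refine (hmax (b, d) (Finset.mem_sdiff.2 ⟨hbdE, hbdF⟩)).not_gt ?_
    have hleft : degU (E \ F) a = (((E \ F).filter fun p => p.1 = a).image Prod.snd).card := by
      refine (Finset.card_image_of_injOn ?_).symm
      intro p hp q hq hpq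
      simp only [Finset.coe_filter, Set.mem_ofPred_eq] at hp hq
      exact Prod.ext (hp.2.trans hq.2.symm) hpq
    have hright : degU (E \ F) b = (((E \ F).filter fun p => p.1 = b).image Prod.snd).card := by
      refine (Finset.card_image_of_injOn ?_).symm
      intro p hp q hq hpq
      simp only [Finset.coe_filter, Set.mem_ofPred_eq] at hp hq
      exact Prod.ext (hp.2.trans hq.2.symm) hpq
    rw [hleft, hright]
    refine Finset.card_lt_card (Finset.ssubset_iff_of_subset ?_ |>.2 ⟨d, ?_, ?_⟩)
    · intro x hx
      simp only [Finset.mem_image, Finset.mem_filter, Finset.mem_sdiff, Prod.exists] at hx ⊢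
      obtain ⟨_, _, ⟨hx, rfl⟩, rfl⟩ := hx
      exact ⟨b, _, ⟨hcon _ hx.1 hx.2, rfl⟩, rfl⟩
    · simpa using ⟨hbdE, hbdF⟩
    · simp [hadE]
  obtain ⟨x, haxE, haxF, hbx⟩ := hex
  by_cases hbxE : (b, x) ∈ E
  · have hbxF : (b, x) ∈ F := by tauto
    exact .inr (exists_isSwap_closer' hadF hbxF haxF hbdF hadE haxE hbdE)
  · exact .inl (_root_.exists_isSwap_closer haxE hbdE hadE hbxE haxF hbdF hadF)

theorem SwapChain.cons {E E' F : Finset (U × V)} {m : ℕ} (h : IsSwap E E')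
    (hc : SwapChain E' F m) : SwapChain E F (m + 1) := by
  obtain ⟨f, h0, hm, hf⟩ := hc
  refine ⟨fun n => Nat.casesOn n E f, rfl, hm, ?_⟩
  rintro (_ | i) hi
  · simpa [h0] using h
  · exact hf i (by omega)

theorem SwapChain.snoc {E F F' : Finset (U × V)} {m : ℕ} (hc : SwapChain E F' m)
    (h : IsSwap F' F) : SwapChain E F (m + 1) := by
  obtain ⟨f, h0, hm, hf⟩ := hc
  refine ⟨fun n => if n ≤ m then f n else F, by simpa using h0, by simp, ?_⟩
  intro i hi
  rcases (Nat.lt_succ_iff.1 hi).eq_or_lt with rfl | hlt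
  · simpa [hm] using h
  · simpa [hlt.le, Nat.succ_le_of_lt hlt] using hf i hlt

/-- Realizations of the same bipartite degree sequence are joined by at most `|E \ F|` swaps. -/
theorem SameDegrees.exists_swapChain {E F : Finset (U × V)} (h : SameDegrees E F) :
    ∃ m ≤ (E \ F).card, SwapChain E F m := by
  induction hn : (E \ F).card using Nat.strong_induction_on generalizing E F with
  | _ n ih =>
    subst hn
    have hcard := Finset.card_sdiff_comm h.card_eq
    rcases (E \ F).eq_empty_or_nonempty with hempty | hne
    · have heq : E = F := Finset.eq_of_subset_of_card_le (Finset.sdiff_eq_empty_iff_subset.1 hempty)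
        h.card_eq.ge
      exact ⟨0, Nat.zero_le _, fun _ => E, rfl, heq, fun i hi => absurd hi i.not_lt_zero⟩
    · rcases h.exists_isSwap_closer hne with ⟨E', hs, hd, hlt⟩ | ⟨F', hs, hd, hlt⟩
      · obtain ⟨m, hm, hc⟩ := ih _ hlt (hd.trans h) rfl
        exact ⟨m + 1, by omega, hc.cons hs⟩
      · have hEF' := h.trans hd.symm
        rw [← hcard, ← Finset.card_sdiff_comm hEF'.card_eq] at hlt
        obtain ⟨m, hm, hc⟩ := ih _ hlt hEF' rfl
        exact ⟨m + 1, by omega, hc.snoc hs.symm⟩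

end Swap

/-- The swap distance of any two realizations of the same bipartite
degree sequence is at most `2e`, where `e` is the number of edges of either
realization; equivalently, the diameter of the Markov graph `𝔾` is at most `2e`. -/
theorem swapDist_le {U V : Type*} [DecidableEq U] [DecidableEq V] (E₁ E₂ : Finset (U × V))
    (hU : ∀ u : U, degU E₁ u = degU E₂ u) (hV : ∀ v : V, degV E₁ v = degV E₂ v) :
    swapDist E₁ E₂ ≤ 2 * E₁.card := by
  obtain ⟨m, hm, hc⟩ := SameDegrees.exists_swapChain (E := E₁) (F := E₂) ⟨hU, hV⟩
  have hdist : swapDist E₁ E₂ ≤ m := Nat.sInf_le hc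
  have hcard : (E₁ \ E₂).card ≤ E₁.card := Finset.card_le_card Finset.sdiff_subset
  omega
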